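/- Let A be a Cohen–Macaulay local ring, N a finite A-module with minimal MCM approximation 0 → L → M → N → 0 and minimal FID hull 0 → N → L' → M' → 0. For a prime p ≠ m_A at which N_p is free over A_p and A_p is regular, all four modules L_p, M_p, L'_p, M'_p are finite free A_p-modules. Consequently, if the pair (A, N) has an isolated singularity, then so do the pairs (A, M), (A, L), (A, L'), (A, M'). -/

import Mathlib

open TensorProduct IsLocalRing

section

variable (A : Type) [CommRing A] [IsLocalRing A]

/-- The localization of `M` at a prime `p` is a free module. -/
def LocFree (p : Ideal A) [p.IsPrime] (M : Type) [AddCommGroup M] [Module A M] : Prop :=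
  Module.Free (Localization.AtPrime p) (LocalizedModule p.primeCompl M)

/-- `A_p` is a regular local ring: its maximal ideal is generated by a regular sequence. -/
def IsRegAt (p : Ideal A) [p.IsPrime] : Prop :=
  ∃ rs : List (Localization.AtPrime p),
    Ideal.span {x | x ∈ rs} = maximalIdeal (Localization.AtPrime p) ∧
    RingTheory.Sequence.IsRegular (Localization.AtPrime p) rs

/-- `M` is maximal Cohen–Macaulay: it admits a regular sequence in the maximal ideal of
length equal to the Krull dimension of `A`. -/
def IsMCM (M : Type) [AddCommGroup M] [Module A M] : Prop :=
  ∃ rs : List A, (∀ r ∈ rs, r ∈ maximalIdeal A) ∧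
    RingTheory.Sequence.IsRegular M rs ∧
    ((rs.length : WithBot (WithTop ℕ)) = ringKrullDim A)

/-- `L` has a finite resolution by finite direct sums of copies of `ω` (the witness for
finite injective dimension over a CM local ring with canonical module `ω`). -/
def FiniteOmegaRes (ω L : Type) [AddCommGroup ω] [Module A ω]
    [AddCommGroup L] [Module A L] : Prop :=
  ∃ (F : ℕ → ℕ) (nmax : ℕ), (∀ i ≥ nmax, F i = 0) ∧
    ∃ (d : ∀ i : ℕ, (Fin (F (i + 1)) → ω) →ₗ[A] (Fin (F i) → ω))
      (aug : (Fin (F 0) → ω) →ₗ[A] L),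
      Function.Surjective aug ∧ Function.Exact (d 0) aug ∧
      ∀ i, Function.Exact (d (i + 1)) (d i)

/-- The pair `(A, X)` has an isolated singularity: away from the closed point, `A` is
regular and `X` is free. -/
def PairIsolated (X : Type) [AddCommGroup X] [Module A X] : Prop :=
  ∀ (p : Ideal A) [p.IsPrime], p ≠ maximalIdeal A → IsRegAt A p ∧ LocFree A p X

end

section helpers
open RingTheory.Sequence CategoryTheory Abelian Pointwise

/-- there is a regular sequence of length `n` in the maximal ideal -/
def HasSeq (R : Type) [CommRing R] [IsLocalRing R] (n : ℕ) (M : Type) [AddCommGroup M] [Module R M] : Prop :=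
  ∃ rs : List R, rs.length = n ∧ (∀ r ∈ rs, r ∈ maximalIdeal R) ∧ IsRegular M rs

section
variable {R : Type} [CommRing R] [IsLocalRing R] [IsNoetherianRing R]

lemma smul_lt_of_nontrivial (M : Type) [AddCommGroup M] [Module R M] [Module.Finite R M]
    [Nontrivial M] : maximalIdeal R • (⊤ : Submodule R M) < ⊤ := by
  refine lt_top_iff_ne_top.mpr fun h => ?_
  have := Submodule.eq_bot_of_le_smul_of_le_jacobson_bot (maximalIdeal R) (⊤ : Submodule R M)
    Module.Finite.fg_top h.ge (maximalIdeal_le_jacobson _)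
  exact bot_ne_top this.symm

lemma HasSeq.drop {n : ℕ} {M : Type} [AddCommGroup M] [Module R M] [Module.Finite R M]
    (h : HasSeq R (n + 1) M) {x : R} (hx : x ∈ maximalIdeal R) (hr : IsSMulRegular M x) :
    HasSeq R n (QuotSMulTop x M) := by
  have : Nontrivial M := by
    obtain ⟨rs, -, -, h⟩ := h
    exact h.nontrivial
  have : Nontrivial (QuotSMulTop x M) := nontrivial_quotSMulTop_of_mem_maximalIdeal _ hx
  have h1 := ((ModuleCat.exists_isRegular_tfae (maximalIdeal R) (n+1) (ModuleCat.of R M)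
    (smul_lt_of_nontrivial M)).out 1 3).mpr h
  refine ((ModuleCat.exists_isRegular_tfae (maximalIdeal R) n (ModuleCat.of R (QuotSMulTop x M))
    (smul_lt_of_nontrivial (QuotSMulTop x M))).out 1 3).mp ?_
  intro i hi
  have zero1 := AddCommGrpCat.isZero_of_iff_subsingleton.mpr (h1 i (by omega))
  have zero2 := AddCommGrpCat.isZero_of_iff_subsingleton.mpr (h1 (i + 1) (by omega))
  exact AddCommGrpCat.subsingleton_of_isZero <| ShortComplex.Exact.isZero_of_both_zeros
        ((Ext.covariant_sequence_exact₃' _ (IsSMulRegular.smulShortComplex_shortExact (M := ModuleCat.of R M) hr)) i (i + 1) rfl)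
        (zero1.eq_zero_of_src _) (zero2.eq_zero_of_tgt _)

lemma exists_ass_quot {M : Type} [AddCommGroup M] [Module R M] [Module.Finite R M] {x : R}
    (hx : x ∈ maximalIdeal R) (hr : IsSMulRegular M x) {q : Ideal R}
    (hq : IsAssociatedPrime q M) :
    ∃ q', IsAssociatedPrime q' (QuotSMulTop x M) ∧ q < q' := by
  rw [isAssociatedPrime_iff] at hq
  obtain ⟨hqp, m, hm⟩ := hq
  have hm' : ∀ r, r ∈ q ↔ r • m = 0 := by
    intro r; rw [hm]; simp [Submodule.mem_colon_singleton]
  have hm0 : m ≠ 0 := by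
    rintro rfl
    exact hqp.ne_top (Ideal.eq_top_iff_one _ |>.mpr ((hm' 1).mpr (by simp)))
  let U : Submodule R M := 
    { carrier := {u | ∀ r ∈ q, r • u = 0}
      add_mem' := by
        intro a b ha hb r hr
        rw [smul_add, ha r hr, hb r hr, add_zero]
      zero_mem' := by intro r _; simp
      smul_mem' := by
        intro c a ha r hr
        rw [smul_comm, ha r hr, smul_zero] }
  have hmU : m ∈ U := fun r hr => (hm' r).mp hr
  have hxq : x ∉ q := by
    intro h
    exact hm0 (hr.right_eq_zero_of_smul ((hm' x).mp h))
  obtain ⟨u, huU, hu⟩ : ∃ u ∈ U, u ∉ x • (⊤ : Submodule R M) := by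
    by_contra! hcon
    have : U = ⊥ := by
      refine Submodule.eq_bot_of_le_smul_of_le_jacobson_bot (maximalIdeal R) U
        (IsNoetherian.noetherian U) ?_ (maximalIdeal_le_jacobson _)
      intro u hu
      have h1 := hcon u hu
      obtain ⟨v, -, hv⟩ := (Submodule.mem_smul_pointwise_iff_exists _ _ _).mp h1
      rw [← hv]
      refine Submodule.smul_mem_smul hx ?_
      intro r hrq
      refine hr.right_eq_zero_of_smul ?_
      rw [smul_comm, hv]
      exact hu r hrq
    rw [this] at hmU
    exact hm0 (by simpa using hmU)
  have hu0 : (Submodule.Quotient.mk u : QuotSMulTop x M) ≠ 0 := by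
    rwa [ne_eq, Submodule.Quotient.mk_eq_zero]
  obtain ⟨P, hP, hle⟩ := exists_le_isAssociatedPrime_of_isNoetherianRing R _ hu0
  have hxP : x ∈ P := by
    apply hle
    rw [Submodule.mem_colon_singleton, Submodule.mem_bot, ← Submodule.Quotient.mk_smul,
      Submodule.Quotient.mk_eq_zero]
    exact Submodule.smul_mem_pointwise_smul u x ⊤ trivial
  refine ⟨P, hP, lt_of_le_of_ne ?_ ?_⟩
  · intro r hrq
    apply hle
    rw [Submodule.mem_colon_singleton, Submodule.mem_bot, ← Submodule.Quotient.mk_smul,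
      huU r hrq, Submodule.Quotient.mk_zero]
  · rintro rfl
    exact hxq hxP

lemma succ_le_dim {q q' : Ideal R} [hq : q.IsPrime] (hlt : q < q') (n : ℕ)
    (h : (n : WithBot ℕ∞) ≤ ringKrullDim (R ⧸ q')) :
    ((n + 1 : ℕ) : WithBot ℕ∞) ≤ ringKrullDim (R ⧸ q) := by
  rw [ringKrullDim_quotient] at h ⊢
  rw [Order.le_krullDim_iff] at h ⊢
  obtain ⟨l, hl⟩ := h
  let f : PrimeSpectrum.zeroLocus (R := R) q' → PrimeSpectrum.zeroLocus (R := R) q :=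
    fun a => ⟨a.1, hlt.le.trans a.2⟩
  have hf : StrictMono f := fun a b hab => hab
  refine ⟨(l.map f hf).cons ⟨⟨q, hq⟩, le_refl q⟩ ?_, ?_⟩
  · exact lt_of_lt_of_le hlt l.head.2
  · simp [hl]

lemma HasSeq.le_dim {n : ℕ} {M : Type} [AddCommGroup M] [Module R M] [Module.Finite R M]
    (h : HasSeq R n M) {q : Ideal R} (hq : IsAssociatedPrime q M) :
    (n : WithBot ℕ∞) ≤ ringKrullDim (R ⧸ q) := by
  induction n generalizing M q with
  | zero =>
    have := hq.isPrime
    simpa using ringKrullDim_nonneg_of_nontrivial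
  | succ n ih =>
    obtain ⟨rs, hl, hm, hreg⟩ := h
    match rs, hl with
    | x :: rs, hl =>
      rw [isRegular_cons_iff] at hreg
      obtain ⟨q', hq', hlt⟩ := exists_ass_quot (hm x (by simp)) hreg.1 hq
      have h1 := ih (M := QuotSMulTop x M) ⟨rs, by simpa using hl, fun r hr => hm r (by simp [hr]), hreg.2⟩ hq'
      have := hq.isPrime
      exact succ_le_dim hlt n h1

lemma supportDim_mono {M N : Type} [AddCommGroup M] [Module R M] [AddCommGroup N] [Module R N]
   (h : Module.support R M ⊆ Module.support R N) : Module.supportDim R M ≤ Module.supportDim R N :=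
  Order.krullDim_le_of_strictMono (fun a ↦ ⟨a.1, h a.2⟩) fun {_ _} lt ↦ lt

lemma supportDim_le_add_length (xs : List R) (hxs : ∀ x ∈ xs, x ∈ maximalIdeal R)
    (M : Type) [AddCommGroup M] [Module R M] [Module.Finite R M] :
    Module.supportDim R M ≤
      Module.supportDim R (M ⧸ (Ideal.ofList xs • ⊤ : Submodule R M)) + (xs.length : WithBot ℕ∞) := by
  induction xs generalizing M with
  | nil =>
    rw [Ideal.ofList_nil, Submodule.bot_smul]
    simpa using (Module.supportDim_eq_of_equiv (Submodule.quotEquivOfEqBot (⊥ : Submodule R M) rfl)).ge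
  | cons x rs' ih =>
    have h1 := ih (fun r hr => hxs r (by simp [hr])) (QuotSMulTop x M)
    have h2 := Module.supportDim_le_supportDim_quotSMulTop_succ (M := M) (hxs x (by simp))
    rw [Module.supportDim_eq_of_equiv (Submodule.quotOfListConsSMulTopEquivQuotSMulTopInner M x _)]
    refine h2.trans ((add_le_add_left h1 1).trans ?_)
    simp [add_assoc]

lemma HasSeq.isWeaklyRegular {n : ℕ} (xs : List R) (hxs : ∀ x ∈ xs, x ∈ maximalIdeal R)
    {M : Type} [AddCommGroup M] [Module R M] [Module.Finite R M] (h : HasSeq R n M)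
    (hd : Module.supportDim R (M ⧸ (Ideal.ofList xs • ⊤ : Submodule R M)) + (xs.length : WithBot ℕ∞)
      ≤ n) : IsWeaklyRegular M xs := by
  induction xs generalizing M n with
  | nil => simp
  | cons x xs ih =>
    have hM : Nontrivial M := by
      obtain ⟨rs, -, -, h⟩ := h
      exact h.nontrivial
    have hx := hxs x (by simp)
    have hreg : IsSMulRegular M x := by
      by_contra hcon
      have : x ∈ ⋃ p ∈ associatedPrimes R M, (p : Set R) := by
        rw [biUnion_associatedPrimes_eq_compl_regular]; exact hcon
      simp only [Set.mem_iUnion] at this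
      obtain ⟨q, hq, hxq⟩ := this
      have h1 := h.le_dim hq
      rw [← Module.supportDim_quotient_eq_ringKrullDim] at h1
      have h2 := supportDim_le_add_length xs (fun r hr => hxs r (by simp [hr])) (R ⧸ q)
      have h3 : Module.supportDim R ((R ⧸ q) ⧸ (Ideal.ofList xs • ⊤ : Submodule R (R ⧸ q))) ≤
          Module.supportDim R (M ⧸ (Ideal.ofList (x :: xs) • ⊤ : Submodule R M)) := by
        apply supportDim_mono
        rw [Module.support_quotient, Module.support_quotient]
        rintro p ⟨hp1, hp2⟩
        have hp1' : q ≤ p.asIdeal := by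
          rw [Module.support_eq_zeroLocus, Ideal.annihilator_quotient] at hp1
          exact hp1
        refine ⟨?_, ?_⟩
        · rw [Module.support_eq_zeroLocus]
          have := hq.annihilator_le
          rw [Submodule.annihilator_top] at this
          exact this.trans hp1'
        · rw [Ideal.ofList_cons]
          exact sup_le ((Ideal.span_singleton_le_iff_mem _).mpr (hp1' hxq)) hp2
      have h4 := h1.trans h2
      generalize Module.supportDim R ((R ⧸ q) ⧸ (Ideal.ofList xs • ⊤ : Submodule R (R ⧸ q))) = a at *
      generalize Module.supportDim R (M ⧸ (Ideal.ofList (x :: xs) • ⊤ : Submodule R M)) = b at *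
      have h5 : a + (xs.length : WithBot ℕ∞) + 1 ≤ n := by
        refine le_trans ?_ hd
        push_cast [List.length_cons]
        rw [add_assoc]
        gcongr
      have h6 : (n : WithBot ℕ∞) + 1 ≤ n := (add_le_add_left h4 1).trans h5
      have : n + 1 ≤ n := by exact_mod_cast h6
      omega
    rw [isWeaklyRegular_cons_iff]
    refine ⟨hreg, ?_⟩
    rw [Module.supportDim_eq_of_equiv (Submodule.quotOfListConsSMulTopEquivQuotSMulTopInner M x _)] at hd
    have hnt : Nontrivial (M ⧸ (Ideal.ofList (x :: xs) • ⊤ : Submodule R M)) := by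
      rw [Submodule.Quotient.nontrivial_iff]
      refine ne_of_lt (lt_of_le_of_lt (Submodule.smul_mono_left ?_) (smul_lt_of_nontrivial M))
      exact Ideal.span_le.mpr hxs
    have hnt' := (Submodule.quotOfListConsSMulTopEquivQuotSMulTopInner M x xs).symm.toEquiv.nontrivial
    have hb := (Module.supportDim_ne_bot_iff_nontrivial R (QuotSMulTop x M ⧸
      (Ideal.ofList xs • ⊤ : Submodule R (QuotSMulTop x M)))).mpr hnt'
    have ih' := fun n h => ih (n := n) (fun r hr => hxs r (by simp [hr])) (M := QuotSMulTop x M) h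
    generalize Module.supportDim R (QuotSMulTop x M ⧸
      (Ideal.ofList xs • ⊤ : Submodule R (QuotSMulTop x M))) = a at *
    obtain ⟨a, rfl⟩ := WithBot.ne_bot_iff_exists.mp hb
    have hd' : a + ((xs.length + 1 : ℕ) : ℕ∞) ≤ (n : ℕ∞) := by exact_mod_cast hd
    obtain ⟨a, rfl⟩ : ∃ b : ℕ, (b : ℕ∞) = a := by
      refine ENat.ne_top_iff_exists.mp ?_
      rintro rfl
      simp at hd'
    have hd2 : a + (xs.length + 1) ≤ n := by exact_mod_cast hd'
    obtain ⟨k, rfl⟩ : ∃ k, n = k + 1 := ⟨n - 1, by omega⟩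
    refine ih' k (h.drop hx hreg) ?_
    have : a + xs.length ≤ k := by omega
    exact_mod_cast this

end

lemma free_of_span (n : ℕ) : ∀ (R : Type) [CommRing R] [IsLocalRing R] [IsNoetherianRing R]
    (rs : List R) (_ : rs.length = n) (hrs : Ideal.ofList rs = maximalIdeal R) (M : Type) [AddCommGroup M] [Module R M] [Module.Finite R M]
    (h : IsWeaklyRegular M rs), Module.Free R M := by
  induction n with
  | zero =>
    intro R _ _ _ rs hl hrs M _ _ _ h
    obtain rfl := List.length_eq_zero_iff.mp hl
    rw [Ideal.ofList_nil] at hrs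
    have : IsField R := (IsLocalRing.isField_iff_maximalIdeal_eq).mpr hrs.symm
    let _ := this.toField
    exact Module.Free.of_divisionRing R M
  | succ n ih =>
    intro R _ _ _ rs hl hrs M _ _ _ h
    obtain ⟨x, rs, rfl⟩ := List.exists_cons_of_length_eq_add_one hl
    rw [isWeaklyRegular_cons_iff'] at h
    have hx : x ∈ maximalIdeal R := by
      rw [← hrs, Ideal.ofList_cons]
      exact Ideal.mem_sup_left (Ideal.mem_span_singleton_self x)
    have : Nontrivial (R ⧸ Ideal.span {x}) := 
      Ideal.Quotient.nontrivial_iff.mpr (by simpa [Ideal.span_singleton_eq_top] using hx)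
    have : IsLocalRing (R ⧸ Ideal.span {x}) := .of_surjective' _ Ideal.Quotient.mk_surjective
    have : Module.FinitePresentation R M := Module.finitePresentation_of_finite R M
    rw [← Module.free_quotSMulTop_iff_free R M (maximalIdeal_le_jacobson _ hx) h.1]
    have := Module.Finite.of_restrictScalars_finite R (R ⧸ Ideal.span {x}) (QuotSMulTop x M)
    refine ih _ _ (by simpa using hl) ?_ _ h.2
    rw [← Ideal.map_ofList]
    have h1 : Ideal.map (Ideal.Quotient.mk (Ideal.span {x})) (maximalIdeal R) =
        maximalIdeal (R ⧸ Ideal.span {x}) := by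
      exact IsLocalRing.map_maximalIdeal_of_surjective _ Ideal.Quotient.mk_surjective
    rw [← h1, ← hrs, Ideal.ofList_cons, Ideal.map_sup, Ideal.map_quotient_self, bot_sup_eq]

lemma dim_quot_add_height {R : Type} [CommRing R] [IsLocalRing R] [IsNoetherianRing R] (J : Ideal R) (h : ℕ) (hJ : h ≤ J.height) :
    ringKrullDim (R ⧸ J) + h ≤ ringKrullDim R := by
  by_cases hJt : J = ⊤
  · subst hJt
    have : Subsingleton (R ⧸ (⊤ : Ideal R)) := Ideal.Quotient.subsingleton_iff.mpr rfl
    rw [ringKrullDim_eq_bot_of_subsingleton]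
    simp
  have : Nontrivial (R ⧸ J) := Ideal.Quotient.nontrivial_iff.mpr hJt
  have : IsLocalRing (R ⧸ J) := .of_surjective' _ Ideal.Quotient.mk_surjective
  obtain ⟨a, ha⟩ := WithBot.ne_bot_iff_exists.mp (ringKrullDim_ne_bot (R := R ⧸ J))
  have ha2 : a ≠ ⊤ := by
    rintro rfl
    exact (ringKrullDim_ne_top (R := R ⧸ J)) ha.symm
  obtain ⟨n, rfl⟩ := ENat.ne_top_iff_exists.mp ha2
  have hn : (n : WithBot ℕ∞) ≤ ringKrullDim (R ⧸ J) := ha.le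
  rw [← ha]
  rw [ringKrullDim_quotient, Order.le_krullDim_iff] at hn
  obtain ⟨l, rfl⟩ := hn
  have key : ∀ k (hk : k < l.length + 1), ((h + k : ℕ) : ℕ∞) ≤ (l ⟨k, hk⟩).1.asIdeal.height := by
    intro k
    induction k with
    | zero =>
      intro hk
      exact hJ.trans (Ideal.height_mono (l _).2)
    | succ k ih =>
      intro hk
      have h1 := ih (by omega)
      have h2 : (l ⟨k, by omega⟩).1.asIdeal < (l ⟨k+1, hk⟩).1.asIdeal :=
        l.strictMono (show (⟨k, by omega⟩ : Fin (l.length + 1)) < ⟨k + 1, hk⟩ from Nat.lt_succ_self k)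
      refine le_trans ?_ (Ideal.height_add_one_le_of_lt_of_isPrime h2)
      push_cast at h1 ⊢
      rw [← add_assoc]
      gcongr
  have h3 := key l.length (by omega)
  have h4 := Ideal.height_le_ringKrullDim_of_isPrime (I := (l ⟨l.length, by omega⟩).1.asIdeal)
  refine le_trans ?_ h4
  rw [add_comm]
  exact_mod_cast h3


lemma exists_list_of_spanRank {R : Type} [CommRing R] [IsNoetherianRing R] (J : Ideal R) (h : ℕ)
    (hJ : J.spanRank ≤ h) : ∃ xs : List R, xs.length ≤ h ∧ Ideal.ofList xs = J := by
  have hs : J.generators.Finite := (IsNoetherian.noetherian J).finite_generators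
  refine ⟨hs.toFinset.toList, ?_, ?_⟩
  · rw [Finset.length_toList, ← Set.ncard_eq_toFinset_card (hs := hs),
      (IsNoetherian.noetherian J).generators_ncard]
    rw [Submodule.fg_iff_spanRank_eq_spanFinrank.mpr (IsNoetherian.noetherian J)] at hJ
    exact_mod_cast hJ
  · have : {r | r ∈ hs.toFinset.toList} = J.generators := by ext; simp
    rw [Ideal.ofList, this]
    exact J.span_generators

lemma supportDim_quot_le {R : Type} [CommRing R] (I : Ideal R) (M : Type) [AddCommGroup M]
    [Module R M] [Module.Finite R M] :
    Module.supportDim R (M ⧸ (I • ⊤ : Submodule R M)) ≤ ringKrullDim (R ⧸ I) := by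
  rw [← Module.supportDim_quotient_eq_ringKrullDim]
  have hsub : Module.support R (M ⧸ (I • ⊤ : Submodule R M)) ⊆ Module.support R (R ⧸ I) := by
    rw [Module.support_quotient, Module.support_eq_zeroLocus (M := R ⧸ I),
      Ideal.annihilator_quotient]
    exact Set.inter_subset_right
  exact Order.krullDim_le_of_strictMono (fun a ↦ ⟨a.1, hsub a.2⟩) fun {_ _} lt ↦ lt

lemma mcm_loc_free {A : Type} [CommRing A] [IsLocalRing A] [IsNoetherianRing A]
    (p : Ideal A) [p.IsPrime] (hreg : IsRegAt A p) (M : Type) [AddCommGroup M] [Module A M]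
    [Module.Finite A M] (hM : IsMCM A M) : LocFree A p M := by
  unfold LocFree
  rcases subsingleton_or_nontrivial (LocalizedModule p.primeCompl M) with hsub | hnt
  · exact Module.Free.of_subsingleton _ _
  obtain ⟨ys, hys, hysr, hysl⟩ := hM
  have hseq : HasSeq A ys.length M := ⟨ys, rfl, hys, hysr⟩
  obtain ⟨h, hh⟩ := ENat.ne_top_iff_exists.mp (Ideal.height_ne_top_of_isPrime (I := p))
  obtain ⟨J, hJp, hJr, hJh⟩ := exists_spanRank_le_and_le_height_of_le_height p h hh.le
  obtain ⟨xs, hxl, hxJ⟩ := exists_list_of_spanRank J h hJr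
  have hxp : ∀ x ∈ xs, x ∈ p := fun x hx => hJp (hxJ ▸ Ideal.subset_span hx)
  -- the elements `xs` form part of a system of parameters
  have hdim := dim_quot_add_height J h hJh
  have hlen : h ≤ xs.length := by
    have h1 := Ideal.height_le_spanRank_toENat J (fun e => (Ideal.IsPrime.ne_top ‹p.IsPrime›)
      (top_le_iff.mp (e ▸ hJp)))
    have h2 : J.spanRank ≤ xs.length := by
      classical
      rw [← hxJ]
      have := Submodule.spanRank_span_le_card (R := A) {r | r ∈ xs}
      refine this.trans ?_
      have e : {r | r ∈ xs} = (xs.toFinset : Set A) := by ext; simp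
      rw [e]
      rw [SetLike.coe_sort_coe, Cardinal.mk_coe_finset]
      exact_mod_cast List.toFinset_card_le xs
    have h3 : J.spanRank.toENat ≤ (xs.length : ℕ∞) := by
      simpa using Cardinal.toENat.monotone' h2
    exact_mod_cast hJh.trans (h1.trans h3)
  have hxlen : xs.length = h := le_antisymm hxl hlen
  have hweak : IsWeaklyRegular M xs := by
    refine hseq.isWeaklyRegular xs (fun x hx => le_maximalIdeal (Ideal.IsPrime.ne_top ‹_›) (hxp x hx)) ?_
    rw [hxlen]
    refine le_trans ?_ (hdim.trans hysl.ge)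
    have := supportDim_quot_le J M
    rw [hxJ]
    gcongr
  have hregp := hweak.isRegular_of_isLocalizedModule_of_mem (Localization.AtPrime p) p
    (LocalizedModule.mkLinearMap p.primeCompl M) hxp
  have hseqp : HasSeq (Localization.AtPrime p) h (LocalizedModule p.primeCompl M) := by
    refine ⟨_, by simpa using hxlen, ?_, hregp⟩
    intro r hr
    obtain ⟨x, hx, rfl⟩ := List.mem_map.mp hr
    exact (IsLocalization.AtPrime.to_map_mem_maximal_iff (Localization.AtPrime p) p x).mpr (hxp x hx)
  obtain ⟨rs, hrs, hrsr⟩ := hreg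
  have hrs' : Ideal.ofList rs = maximalIdeal (Localization.AtPrime p) := hrs
  have hd1 := ringKrullDim_add_length_eq_ringKrullDim_of_isRegular rs hrsr
  rw [IsLocalization.AtPrime.ringKrullDim_eq_height p (Localization.AtPrime p), ← hh] at hd1
  refine free_of_span rs.length _ rs rfl hrs' _ ?_
  refine hseqp.isWeaklyRegular rs (fun x hx => hrs' ▸ Ideal.subset_span hx) ?_
  refine le_trans ?_ hd1.le
  have := supportDim_quot_le (Ideal.ofList rs) (LocalizedModule p.primeCompl M)
  gcongr

lemma split_equiv {A : Type} [CommRing A] (S : Submonoid A)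
    {X Y Z : Type} [AddCommGroup X] [Module A X] [AddCommGroup Y] [Module A Y]
    [AddCommGroup Z] [Module A Z] (f : X →ₗ[A] Y) (g : Y →ₗ[A] Z)
    (hf : Function.Injective f) (hg : Function.Surjective g) (hfg : Function.Exact f g)
    (hZ : Module.Free (Localization S) (LocalizedModule S Z)) :
    Nonempty (LocalizedModule S Y ≃ₗ[Localization S] LocalizedModule S X × LocalizedModule S Z) := by
  have h1 : Function.Injective (LocalizedModule.map S f) := LocalizedModule.map_injective S f hf
  have h2 : Function.Surjective (LocalizedModule.map S g) := LocalizedModule.map_surjective S g hg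
  have h3 : Function.Exact (LocalizedModule.map S f) (LocalizedModule.map S g) :=
    LocalizedModule.map_exact S f g hfg
  obtain ⟨l, hl⟩ := Module.projective_lifting_property (LocalizedModule.map S g) .id h2
  exact ⟨(h3.splitSurjectiveEquiv h1 ⟨l, hl⟩).1⟩

end helpers

/-- Theorem 6.3(i) and its proof: given the minimal MCM approximation
`0 → L → M → N → 0` and minimal FID hull `0 → N → L' → M' → 0` of a finite module `N`
over a CM local ring `A` with canonical module `ω`, at any prime `p ≠ m_A` where `A_p` is
regular and `N_p` is free, all of `L_p, M_p, L'_p, M'_p` are finite free `A_p`-modules;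
consequently, if the pair `(A, N)` has an isolated singularity then so do the pairs
`(A, M)`, `(A, L)`, `(A, L')` and `(A, M')`. -/
theorem stmt_16
    (A : Type) [CommRing A] [IsLocalRing A] [IsNoetherianRing A]
    (hCM : IsMCM A A)
    (ω : Type) [AddCommGroup ω] [Module A ω] [Module.Finite A ω] (hωMCM : IsMCM A ω)
    -- the canonical module localizes to a free module at regular primes
    (hωloc : ∀ (p : Ideal A) [p.IsPrime], p ≠ maximalIdeal A → IsRegAt A p →
      LocFree A p ω)
    (N : Type) [AddCommGroup N] [Module A N] [Module.Finite A N]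
    (L M L' M' : Type) [AddCommGroup L] [Module A L] [Module.Finite A L]
    [AddCommGroup M] [Module A M] [Module.Finite A M]
    [AddCommGroup L'] [Module A L'] [Module.Finite A L']
    [AddCommGroup M'] [Module A M'] [Module.Finite A M']
    -- the MCM approximation 0 → L → M → N → 0
    (j₁ : L →ₗ[A] M) (p₁ : M →ₗ[A] N)
    (hj₁ : Function.Injective j₁) (hp₁ : Function.Surjective p₁)
    (hex₁ : Function.Exact j₁ p₁)
    (hM : IsMCM A M) (hL : FiniteOmegaRes A ω L)
    -- the FID hull 0 → N → L' → M' → 0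
    (j₂ : N →ₗ[A] L') (p₂ : L' →ₗ[A] M')
    (hj₂ : Function.Injective j₂) (hp₂ : Function.Surjective p₂)
    (hex₂ : Function.Exact j₂ p₂)
    (hM' : IsMCM A M') (hL' : FiniteOmegaRes A ω L') :
    (∀ (p : Ideal A) [p.IsPrime], p ≠ maximalIdeal A → IsRegAt A p → LocFree A p N →
      LocFree A p L ∧ LocFree A p M ∧ LocFree A p L' ∧ LocFree A p M') ∧
    (PairIsolated A N →
      PairIsolated A M ∧ PairIsolated A L ∧ PairIsolated A L' ∧ PairIsolated A M') := by
  have main : ∀ (p : Ideal A) [p.IsPrime], p ≠ maximalIdeal A → IsRegAt A p → LocFree A p N →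
      LocFree A p L ∧ LocFree A p M ∧ LocFree A p L' ∧ LocFree A p M' := by
    intro p _ _ hreg hN
    have hMf : LocFree A p M := mcm_loc_free p hreg M hM
    have hMf' : LocFree A p M' := mcm_loc_free p hreg M' hM'
    refine ⟨?_, hMf, ?_, hMf'⟩
    · obtain ⟨e⟩ := split_equiv p.primeCompl j₁ p₁ hj₁ hp₁ hex₁ hN
      unfold LocFree at *
      have : Module.Projective (Localization.AtPrime p) (LocalizedModule p.primeCompl L) :=
        Module.Projective.of_split (e.symm.toLinearMap ∘ₗ LinearMap.inl _ _ _)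
          (LinearMap.fst _ _ _ ∘ₗ e.toLinearMap) (by ext; simp)
      exact Module.free_of_flat_of_isLocalRing
    · obtain ⟨e⟩ := split_equiv p.primeCompl j₂ p₂ hj₂ hp₂ hex₂ hMf'
      unfold LocFree at *
      exact Module.Free.of_equiv e.symm
  refine ⟨main, fun hN => ?_⟩
  refine ⟨?_, ?_, ?_, ?_⟩ <;> intro p _ hp <;> obtain ⟨h1, h2⟩ := hN p hp <;>
    obtain ⟨a, b, c, d⟩ := main p hp h1 h2 <;> exact ⟨h1, by assumption⟩
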